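/- arXiv:1103.0505 — 2 statements merged into one kernel-verified Lean document; each statement's English description precedes it below -/
import Mathlib

section
/- Let N be a positive integer, let c > 0, let b₁, …, b_N > 0, let a₁, …, a_N ≤ 0, and let s > 0. Then the Laplace transform of t ↦ t^{c−1} Φ₂^(N)(b₁,…,b_N; c; a₁ t, …, a_N t) exists and satisfies ∫₀^∞ e^{−s t} t^{c−1} Φ₂^(N)(b₁,…,b_N; c; a₁ t, …, a_N t) dt = Γ(c) · s^{−c} · ∏_{n=1}^N (1 − a_n/s)^{−b_n}. -/
open scoped BigOperators

theorem lau_hasSum_congr {ι M : Type*} [AddCommMonoid M] [TopologicalSpace M] {f g : ι → M} {a : M}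
    (h : ∀ i, f i = g i) : HasSum f a ↔ HasSum g a := by
  rw [funext h]

theorem hasSum_pi_aux : ∀ (N : ℕ) (f : Fin N → ℕ → ℝ) (S : Fin N → ℝ),
    (∀ n, HasSum (f n) (S n)) → HasSum (fun m : Fin N → ℕ => ∏ n, f n (m n)) (∏ n, S n) := by
  intro N
  induction N with
  | zero =>
    intro f S _
    simp only [Finset.univ_eq_empty, Finset.prod_empty]
    exact hasSum_unique (fun _ : Fin 0 → ℕ => (1:ℝ))
  | succ N ih =>
    intro f S h
    have h1 := ih (fun n => f n.succ) (fun n => S n.succ) (fun n => h n.succ)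
    have h0 : Summable (fun x : ℕ × (Fin N → ℕ) => f 0 x.1 * ∏ n : Fin N, f n.succ (x.2 n)) :=
      summable_mul_of_summable_norm (f := f 0) (g := fun y : Fin N → ℕ => ∏ n : Fin N, f n.succ (y n))
        (h 0).summable.norm h1.summable.norm
    have h2 := (h 0).mul h1 h0
    rw [← (Fin.consEquiv (fun _ : Fin (N+1) => ℕ)).hasSum_iff]
    rw [Fin.prod_univ_succ]
    have h3 : ((fun m : Fin (N+1) → ℕ => ∏ n, f n (m n)) ∘ (Fin.consEquiv (fun _ : Fin (N+1) => ℕ)))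
        = fun x : ℕ × (Fin N → ℕ) => f 0 x.1 * ∏ n : Fin N, f n.succ (x.2 n) := by
      funext x
      simp only [Function.comp_apply, Fin.prod_univ_succ]
      rfl
    rw [h3]
    exact h2

theorem binom_hasSum (b x : ℝ) (hx : |x| < 1) :
    HasSum (fun k : ℕ => (ascPochhammer ℝ k).eval b / (Nat.factorial k) * x ^ k) ((1 - x) ^ (-b)) := by
  have h := (Real.one_div_one_sub_rpow_hasFPowerSeriesOnBall_zero b).hasSum (y := x) (by
    rw [Metric.mem_eball, edist_dist, dist_zero_right]
    simpa using hx)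
  rw [zero_add] at h
  rw [Real.rpow_neg (by linarith [abs_lt.1 hx]), ← one_div]
  refine (lau_hasSum_congr fun k => ?_).2 h
  rw [FormalMultilinearSeries.ofScalars_apply_eq, smul_eq_mul, Ring.choose]
  congr 1
  rw [show b + k - 1 - k + 1 = b by ring, ← Polynomial.ascPochhammer_smeval_eq_eval, ← Ring.factorial_nsmul_multichoose_eq_ascPochhammer]
  have : (k.factorial : ℝ) ≠ 0 := by positivity
  field_simp
  simp

theorem gamma_poch (c : ℝ) (hc : 0 < c) (k : ℕ) :
    Real.Gamma (c + k) = (ascPochhammer ℝ k).eval c * Real.Gamma c := by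
  induction k with
  | zero => simp
  | succ k ih =>
    rw [ascPochhammer_succ_eval]
    push_cast
    rw [← add_assoc, Real.Gamma_add_one (by positivity), ih]; ring

theorem poch_add (c : ℝ) (i j : ℕ) : (ascPochhammer ℝ (i + j)).eval c =
    (ascPochhammer ℝ i).eval c * (ascPochhammer ℝ j).eval (c + i) := by
  rw [← ascPochhammer_mul]; simp

theorem poch_summable (c : ℝ) (hc : 0 < c) (x : ℝ) :
    Summable (fun k : ℕ => x ^ k / (ascPochhammer ℝ k).eval c) := by
  by_cases hx : x = 0
  · subst hx
    refine summable_of_ne_finset_zero (s := {0}) ?_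
    intro b hb
    simp at hb
    simp [hb]
  refine summable_of_ratio_test_tendsto_lt_one (l := 0) (by norm_num) ?_ ?_
  · filter_upwards with k
    exact div_ne_zero (pow_ne_zero _ hx) (ascPochhammer_pos k c hc).ne'
  · have : Filter.Tendsto (fun k : ℕ => |x| / (c + k)) Filter.atTop (nhds 0) :=
      Filter.Tendsto.const_div_atTop (Filter.tendsto_atTop_add_const_left _ _ tendsto_natCast_atTop_atTop) _
    refine this.congr fun k => ?_
    have h1 := ascPochhammer_pos k c hc
    have h2 : 0 < c + k := by positivity
    rw [ascPochhammer_succ_eval, ← norm_div, Real.norm_eq_abs, ← abs_of_pos h2, ← abs_div, abs_of_pos h2]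
    congr 1
    field_simp
    ring

theorem uniq_aux (q : ℕ → ℂ) (ε : ℝ) (hε : 0 < ε)
    (hq : ∀ x : ℝ, 0 < x → x < ε → HasSum (fun k => q k * (x:ℂ) ^ k) 0) : q = 0 := by
  set p := FormalMultilinearSeries.ofScalars ℂ q with hp
  by_contra hne
  have hp0 : p ≠ 0 := by
    intro h
    exact hne ((FormalMultilinearSeries.ofScalars_series_eq_zero ℂ).1 h)
  have hrad : ((Real.toNNReal (ε/2) : NNReal) : ENNReal) ≤ p.radius := by
    apply p.le_radius_of_summable_norm
    have := (hq (ε/2) (by positivity) (by linarith)).summable.norm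
    refine this.congr fun k => ?_
    rw [hp, FormalMultilinearSeries.ofScalars_norm]
    rw [Real.coe_toNNReal _ (by positivity)]
    simp [abs_of_pos hε]
  have hpos : 0 < p.radius := lt_of_lt_of_le (by
    rw [ENNReal.coe_pos]; exact Real.toNNReal_pos.2 (by positivity)) hrad
  have h1 := (p.hasFPowerSeriesOnBall hpos).hasFPowerSeriesAt.locally_ne_zero hp0
  have h2 : Filter.Tendsto (fun x : ℝ => (x : ℂ)) (nhdsWithin 0 (Set.Ioi 0)) (nhdsWithin (0:ℂ) {0}ᶜ) := by
    apply tendsto_nhdsWithin_of_tendsto_nhds_of_eventually_within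
    · have := (Complex.continuous_ofReal.tendsto 0).mono_left (nhdsWithin_le_nhds (s := Set.Ioi (0:ℝ)))
      simpa using this
    · filter_upwards [self_mem_nhdsWithin] with x hx
      simpa using (ne_of_gt hx : x ≠ 0)
  have h3 := h2.eventually h1
  have h4 : ∀ᶠ x : ℝ in nhdsWithin 0 (Set.Ioi 0), x ∈ Set.Ioo 0 ε := Ioo_mem_nhdsGT hε
  obtain ⟨x, hx, hx'⟩ := (h3.and h4).exists
  apply hx
  rw [FormalMultilinearSeries.sum]
  have := (hq x hx'.1 hx'.2).tsum_eq
  rw [← this]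
  refine tsum_congr fun k => ?_
  rw [hp, FormalMultilinearSeries.ofScalars_apply_eq, smul_eq_mul]

theorem fiber_aux {ι : Type*} (v : ι → ℝ) (d : ι → ℕ) (φ : ℕ → ℝ) (S : ℝ)
    (h : HasSum (fun i => v i * φ (d i)) S) :
    HasSum (fun k => (∑' i : (d ⁻¹' {k} : Set ι), v i) * φ k) S := by
  have := h.tsum_fiberwise d
  refine (lau_hasSum_congr fun k => ?_).2 this
  rw [← tsum_mul_right]
  refine tsum_congr fun i => ?_
  have hi : d i = k := i.2
  rw [hi]

theorem scaled_summable {ι : Type*} (w : ι → ℝ) (d : ι → ℕ) (c r : ℝ) (hc : 0 < c) (hr : 0 < r)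
    (h : Summable (fun i => w i * r ^ d i)) (t : ℝ) :
    Summable (fun i => w i * (t ^ d i / (ascPochhammer ℝ (d i)).eval c)) := by
  have h0 := (poch_summable c hc (t / r)).tendsto_atTop_zero
  obtain ⟨M, hM⟩ := (h0.norm).bddAbove_range
  refine Summable.of_norm_bounded (h.norm.mul_right M) fun i => ?_
  have h1 : ‖(t / r) ^ d i / (ascPochhammer ℝ (d i)).eval c‖ ≤ M := hM ⟨d i, rfl⟩
  have h2 : w i * (t ^ d i / (ascPochhammer ℝ (d i)).eval c) =
      w i * r ^ d i * ((t / r) ^ d i / (ascPochhammer ℝ (d i)).eval c) := by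
    rw [div_pow]; field_simp
  rw [h2, norm_mul]
  gcongr

theorem core_aux {ι : Type*} (w : ι → ℝ) (d : ι → ℕ) (A c : ℝ) (hA : 0 < A) (hc : 0 < c)
    (g : ℝ → ℝ) (hg : ∀ y, 0 < y → y < 1 / A → HasSum (fun i => w i * y ^ d i) (g y)) :
    ∃ h : ℕ → ℝ,
      (∀ t, HasSum (fun k => h k * (t ^ k / (ascPochhammer ℝ k).eval c))
        (Real.exp (A * t) * ∑' i, w i * (t ^ d i / (ascPochhammer ℝ (d i)).eval c))) ∧
      (∀ z, 0 < z → z < 1 / (2 * A) →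
        HasSum (fun k => h k * z ^ k) ((1 - A * z) ^ (-c) * g (z / (1 - A * z)))) := by
  have hP : ∀ k, 0 < (ascPochhammer ℝ k).eval c := fun k => ascPochhammer_pos k c hc
  let v : ι × ℕ → ℝ := fun x => w x.1 * A ^ x.2 / (x.2.factorial * (ascPochhammer ℝ (d x.1)).eval c)
  let D : ι × ℕ → ℕ := fun x => d x.1 + x.2
  refine ⟨fun k => (∑' i : (D ⁻¹' {k} : Set (ι × ℕ)), v i) * (ascPochhammer ℝ k).eval c, ?_, ?_⟩
  · intro t
    have h1 := (scaled_summable w d c (1 / (2 * A)) hc (by positivity)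
      (hg (1 / (2 * A)) (by positivity) (by
        rw [div_lt_div_iff₀ (by positivity) hA]; linarith)).summable t)
    have h2 : HasSum (fun j : ℕ => (A * t) ^ j / j.factorial) (Real.exp (A * t)) := by
      rw [Real.exp_eq_exp_ℝ]
      exact NormedSpace.expSeries_div_hasSum_exp (A * t)
    have h3 := h1.hasSum.mul h2 (summable_mul_of_summable_norm h1.norm h2.summable.norm)
    have h4 : HasSum (fun x => v x * t ^ D x)
      (Real.exp (A * t) * ∑' i, w i * (t ^ d i / (ascPochhammer ℝ (d i)).eval c)) := by
      rw [mul_comm]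
      refine (lau_hasSum_congr fun x => ?_).2 h3
      simp only [v, D, mul_pow, pow_add]
      have := (hP (d x.1)).ne'
      field_simp
    have h5 := fiber_aux v D (fun k => t ^ k) _ h4
    refine (lau_hasSum_congr fun k => ?_).2 h5
    have := (hP k).ne'
    field_simp
  · intro z hz hz'
    have hz2 : A * z < 1 / 2 := by
      rw [lt_div_iff₀ (by positivity)] at hz'; linarith
    have hAz : 0 < A * z := by positivity
    have h1 : 0 < 1 - A * z := by linarith
    set y := z / (1 - A * z) with hy
    have hy0 : 0 < y := by positivity
    have hy1 : y < 1 / A := by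
      rw [hy, div_lt_div_iff₀ h1 hA]; linarith
    have hgy := hg y hy0 hy1
    have inner : ∀ i, HasSum (fun j : ℕ => (ascPochhammer ℝ j).eval (c + d i) / j.factorial * (A * z) ^ j)
        ((1 - A * z) ^ (-(c + d i))) := fun i =>
      binom_hasSum _ _ (by rw [abs_of_pos hAz]; linarith)
    have hpw : ∀ i, z ^ d i * (1 - A * z) ^ (-(c + d i)) = (1 - A * z) ^ (-c) * y ^ d i := by
      intro i
      rw [neg_add, Real.rpow_add h1, Real.rpow_neg h1.le (d i), Real.rpow_natCast, hy, div_pow]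
      field_simp
    have inner2 : ∀ i (u : ℝ), HasSum (fun j : ℕ => u * z ^ d i *
          ((ascPochhammer ℝ j).eval (c + d i) / j.factorial * (A * z) ^ j))
        ((1 - A * z) ^ (-c) * (u * y ^ d i)) := by
      intro i u
      have := (inner i).mul_left (u * z ^ d i)
      rw [mul_assoc u _ (_ ^ (-(c + (d i : ℝ)))), hpw i] at this
      rwa [show (1 - A * z) ^ (-c) * (u * y ^ d i) = u * ((1 - A * z) ^ (-c) * y ^ d i) by ring]
    let F : ι × ℕ → ℝ := fun x => w x.1 * z ^ d x.1 *
          ((ascPochhammer ℝ x.2).eval (c + d x.1) / x.2.factorial * (A * z) ^ x.2)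
    have hsF : Summable F := by
      rw [← summable_norm_iff]
      have habs : (fun x => ‖F x‖) = fun x : ι × ℕ => |w x.1| * z ^ d x.1 *
          ((ascPochhammer ℝ x.2).eval (c + d x.1) / x.2.factorial * (A * z) ^ x.2) := by
        funext x
        have := ascPochhammer_pos x.2 (c + d x.1) (by positivity)
        simp only [F]
        rw [norm_mul, norm_mul, Real.norm_eq_abs, Real.norm_of_nonneg (by positivity : 0 ≤ z ^ d x.1),
          Real.norm_of_nonneg (by positivity)]
      refine (summable_prod_of_nonneg (fun x => norm_nonneg _)).2 ⟨?_, ?_⟩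
      · intro i
        have := (inner2 i |w i|).summable
        exact this.congr fun j => (congrFun habs (i, j)).symm
      · have h6 : ∀ i, ∑' j, ‖F (i, j)‖ = (1 - A * z) ^ (-c) * (|w i| * y ^ d i) := by
          intro i
          rw [← (inner2 i |w i|).tsum_eq]
          exact tsum_congr fun j => congrFun habs (i, j)
        simp_rw [h6]
        apply Summable.mul_left
        refine hgy.summable.norm.congr fun i => ?_
        rw [norm_mul, Real.norm_eq_abs, Real.norm_of_nonneg (by positivity : 0 ≤ y ^ d i)]
    have hF : HasSum F ((1 - A * z) ^ (-c) * g y) := by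
      have h7 := hsF.hasSum.prod_fiberwise (fun i => inner2 i (w i))
      rw [← h7.unique (hgy.mul_left _)]
      exact hsF.hasSum
    have h8 : HasSum (fun x => v x * ((ascPochhammer ℝ (D x)).eval c * z ^ D x))
        ((1 - A * z) ^ (-c) * g y) := by
      refine (lau_hasSum_congr fun x => ?_).2 hF
      simp only [v, D, F, poch_add, pow_add, mul_pow]
      have := (hP (d x.1)).ne'
      field_simp
    have h9 := fiber_aux v D (fun k => (ascPochhammer ℝ k).eval c * z ^ k) _ h8
    refine (lau_hasSum_congr fun k => ?_).2 h9
    ring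

theorem laplace_series (c σ : ℝ) (hc : 0 < c) (hσ : 0 < σ) (h : ℕ → ℝ) (L : ℝ)
    (hL : HasSum (fun k => h k * (1 / σ) ^ k) L) :
    MeasureTheory.IntegrableOn (fun t : ℝ => Real.exp (-σ * t) * t ^ (c - 1) *
      ∑' k, h k * (t ^ k / (ascPochhammer ℝ k).eval c)) (Set.Ioi 0) ∧
    ∫ t in Set.Ioi (0 : ℝ), Real.exp (-σ * t) * t ^ (c - 1) *
      ∑' k, h k * (t ^ k / (ascPochhammer ℝ k).eval c) = Real.Gamma c * σ ^ (-c) * L := by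
  have hP : ∀ k, 0 < (ascPochhammer ℝ k).eval c := fun k => ascPochhammer_pos k c hc
  let μ := MeasureTheory.volume.restrict (Set.Ioi (0:ℝ))
  let E : ℕ → ℝ → ℝ := fun k t => t ^ (c + k - 1) * Real.exp (-(σ * t))
  let F : ℕ → ℝ → ℝ := fun k t => (h k / (ascPochhammer ℝ k).eval c) * E k t
  have hEint : ∀ k : ℕ, MeasureTheory.Integrable (E k) μ := by
    intro k
    have h0 : (0:ℝ) ≤ k := Nat.cast_nonneg k
    have := integrableOn_rpow_mul_exp_neg_mul_rpow (p := 1) (s := c + k - 1) (b := σ)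
      (by linarith) one_pos hσ
    simp only [Real.rpow_one, neg_mul] at this
    exact this
  have hEval : ∀ k : ℕ, ∫ t, E k t ∂μ =
      (ascPochhammer ℝ k).eval c * (Real.Gamma c * σ ^ (-c) * (1 / σ) ^ k) := by
    intro k
    have h0 : 0 < c + k := by positivity
    have := Real.integral_rpow_mul_exp_neg_mul_Ioi h0 hσ
    simp only [E, μ]
    rw [this, gamma_poch c hc, Real.rpow_add (by positivity), Real.rpow_natCast, one_div,
      Real.inv_rpow hσ.le, Real.rpow_neg hσ.le]
    ring
  have hE0 : ∀ k t, t ∈ Set.Ioi (0:ℝ) → 0 ≤ E k t := by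
    intro k t ht
    have : 0 < t := ht
    positivity
  have hFint : ∀ k, MeasureTheory.Integrable (F k) μ := fun k => (hEint k).const_mul _
  have hFval : ∀ k, ∫ t, F k t ∂μ = Real.Gamma c * σ ^ (-c) * (h k * (1 / σ) ^ k) := by
    intro k
    simp only [F]
    rw [MeasureTheory.integral_const_mul, hEval]
    have := (hP k).ne'
    field_simp
  have hFnorm : ∀ k, ∫ t, ‖F k t‖ ∂μ = Real.Gamma c * σ ^ (-c) * ‖h k * (1 / σ) ^ k‖ := by
    intro k
    have : ∫ t, ‖F k t‖ ∂μ = ∫ t, ‖h k / (ascPochhammer ℝ k).eval c‖ * E k t ∂μ := by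
      apply MeasureTheory.setIntegral_congr_fun measurableSet_Ioi
      intro t ht
      simp only [F]
      rw [norm_mul, Real.norm_of_nonneg (hE0 k t ht)]
    rw [this, MeasureTheory.integral_const_mul, hEval, norm_div, norm_mul,
      Real.norm_of_nonneg (hP k).le, Real.norm_of_nonneg (by positivity : 0 ≤ (1 / σ) ^ k)]
    have := (hP k).ne'
    field_simp
  have hFsum : Summable (fun k => ∫ t, ‖F k t‖ ∂μ) := by
    simp_rw [hFnorm]
    exact hL.summable.norm.mul_left _
  have hFE : ∀ t, t ∈ Set.Ioi (0:ℝ) → ∀ k, F k t = Real.exp (-σ * t) * t ^ (c - 1) *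
      (h k * (t ^ k / (ascPochhammer ℝ k).eval c)) := by
    intro t ht k
    simp only [F, E]
    rw [show c + k - 1 = (c - 1) + k by ring, Real.rpow_add ht, Real.rpow_natCast, neg_mul]
    ring
  have hptw : ∀ t, t ∈ Set.Ioi (0:ℝ) → HasSum (fun k => F k t) (Real.exp (-σ * t) * t ^ (c - 1) *
      ∑' k, h k * (t ^ k / (ascPochhammer ℝ k).eval c)) := by
    intro t ht
    have h1 := scaled_summable h (fun k => k) c (1 / σ) hc (by positivity) hL.summable t
    exact (lau_hasSum_congr (hFE t ht)).2 (h1.hasSum.mul_left _)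
  have hae : ∀ᵐ t ∂μ, HasSum (fun k => F k t) (Real.exp (-σ * t) * t ^ (c - 1) *
      ∑' k, h k * (t ^ k / (ascPochhammer ℝ k).eval c)) :=
    (MeasureTheory.ae_restrict_mem measurableSet_Ioi).mono hptw
  constructor
  · refine ⟨?_, ?_⟩
    · refine aestronglyMeasurable_of_tendsto_ae Filter.atTop
        (f := fun n t => ∑ k ∈ Finset.range n, F k t) ?_ ?_
      · intro n
        exact (MeasureTheory.integrable_finsetSum _ fun k _ => hFint k).1
      · exact hae.mono fun t ht => ht.tendsto_sum_nat
    · rw [MeasureTheory.hasFiniteIntegral_iff_enorm]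
      calc _ ≤ ∫⁻ t, ∑' k, ‖F k t‖ₑ ∂μ := by
            apply MeasureTheory.lintegral_mono_ae
            filter_upwards [hae] with t ht
            rw [← ht.tsum_eq]
            exact enorm_tsum_le_tsum_enorm
        _ = ∑' k, ∫⁻ t, ‖F k t‖ₑ ∂μ :=
            MeasureTheory.lintegral_tsum fun k => (hFint k).1.enorm
        _ = ∑' k, ENNReal.ofReal (∫ t, ‖F k t‖ ∂μ) := by
            refine tsum_congr fun k => ?_
            rw [MeasureTheory.ofReal_integral_norm_eq_lintegral_enorm (hFint k)]
        _ < ⊤ := hFsum.tsum_ofReal_lt_top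
  · have h1 := MeasureTheory.hasSum_integral_of_summable_integral_norm hFint hFsum
    simp_rw [hFval] at h1
    have h2 := h1.unique (hL.mul_left _)
    rw [← h2]
    apply MeasureTheory.integral_congr_ae
    filter_upwards [hae] with t ht
    exact ht.tsum_eq.symm

theorem extend_aux (h : ℕ → ℝ) (ε R : ℝ) (hε : 0 < ε) (hεR : ε ≤ R) (G : ℂ → ℂ)
    (hG : DifferentiableOn ℂ G (Metric.ball 0 R))
    (hs : ∀ x : ℝ, 0 < x → x < ε → HasSum (fun k => (h k : ℂ) * (x:ℂ) ^ k) (G x)) :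
    ∀ x : ℝ, 0 < x → x < R → HasSum (fun k => (h k : ℂ) * (x:ℂ) ^ k) (G x) := by
  let p : ℕ → ℂ := fun n => (n.factorial : ℂ)⁻¹ * iteratedDeriv n G 0
  have hp : ∀ x : ℝ, 0 < x → x < R → HasSum (fun k => p k * (x:ℂ) ^ k) (G x) := by
    intro x hx hxR
    have := Complex.hasSum_taylorSeries_on_ball hG (z := (x:ℂ)) (by simp [abs_of_pos hx, hxR])
    refine (lau_hasSum_congr fun k => ?_).2 this
    simp only [p, smul_eq_mul, sub_zero]
    ring
  have hq : (fun k => (h k : ℂ) - p k) = 0 := by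
    refine uniq_aux _ ε hε fun x hx hxε => ?_
    have := (hs x hx hxε).sub (hp x hx (by linarith))
    rw [sub_self] at this
    refine (lau_hasSum_congr fun k => ?_).2 this
    ring
  have hq' : ∀ k, (h k : ℂ) = p k := fun k => sub_eq_zero.1 (congrFun hq k)
  simp_rw [hq']
  exact hp

/-- The confluent Lauricella function `Φ₂^(N)`, defined by the multiple power series
`Φ₂^(N)(b₁,…,b_N; c; x₁,…,x_N)
  = Σ_{(m₁,…,m_N)∈ℕ^N} [(b₁)_{m₁}⋯(b_N)_{m_N} / (c)_{m₁+⋯+m_N}]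
      · x₁^{m₁}⋯x_N^{m_N}/(m₁!⋯m_N!)`. -/
noncomputable def lauricellaPhi2 (N : ℕ) (b : Fin N → ℝ) (c : ℝ) (x : Fin N → ℝ) : ℝ :=
  ∑' m : Fin N → ℕ,
    ((∏ n, (ascPochhammer ℝ (m n)).eval (b n)) / (ascPochhammer ℝ (∑ n, m n)).eval c) *
      ∏ n, x n ^ m n / (Nat.factorial (m n))

/-- Laplace transform of `t ↦ t^{c−1} Φ₂^(N)(b; c; a₁ t, …, a_N t)`:
it exists and equals `Γ(c) · s^{−c} · ∏ (1 − aₙ/s)^{−bₙ}`. -/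
theorem laplace_lauricellaPhi2 (N : ℕ) (hN : 0 < N) (c : ℝ) (hc : 0 < c)
    (b : Fin N → ℝ) (hb : ∀ n, 0 < b n) (a : Fin N → ℝ) (ha : ∀ n, a n ≤ 0)
    (s : ℝ) (hs : 0 < s) :
    MeasureTheory.IntegrableOn
      (fun t : ℝ => Real.exp (-s * t) * t ^ (c - 1) *
        lauricellaPhi2 N b c (fun n => a n * t)) (Set.Ioi 0) ∧
    ∫ t in Set.Ioi (0 : ℝ), Real.exp (-s * t) * t ^ (c - 1) *
        lauricellaPhi2 N b c (fun n => a n * t) =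
      Real.Gamma c * s ^ (-c) * ∏ n, (1 - a n / s) ^ (-(b n)) := by
  set A : ℝ := 1 + ∑ n, |a n| with hAdef
  have hA1 : ∀ n, |a n| < A := by
    intro n
    have := Finset.single_le_sum (f := fun n => |a n|) (fun i _ => abs_nonneg _) (Finset.mem_univ n)
    linarith
  have hA : 0 < A := by positivity
  set B : ℝ := ∑ n, b n with hB
  let w : (Fin N → ℕ) → ℝ := fun m => ∏ n, ((ascPochhammer ℝ (m n)).eval (b n) /
    (Nat.factorial (m n)) * a n ^ m n)
  let d : (Fin N → ℕ) → ℕ := fun m => ∑ n, m n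
  let g : ℝ → ℝ := fun y => ∏ n, (1 - a n * y) ^ (-(b n))
  have hg : ∀ y, 0 < y → y < 1 / A → HasSum (fun m => w m * y ^ d m) (g y) := by
    intro y hy hyA
    have h1 := hasSum_pi_aux N (fun n k => (ascPochhammer ℝ k).eval (b n) /
      (Nat.factorial k) * (a n * y) ^ k) (fun n => (1 - a n * y) ^ (-(b n))) (fun n => by
        apply binom_hasSum
        rw [abs_mul, abs_of_pos hy]
        rw [lt_div_iff₀ hA] at hyA
        nlinarith [hA1 n])
    refine (lau_hasSum_congr fun m => ?_).2 h1
    simp only [w, d]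
    rw [← Finset.prod_pow_eq_pow_sum, ← Finset.prod_mul_distrib]
    refine Finset.prod_congr rfl fun n _ => ?_
    rw [mul_pow]; ring
  have hPhi : ∀ t, lauricellaPhi2 N b c (fun n => a n * t) =
      ∑' m, w m * (t ^ d m / (ascPochhammer ℝ (d m)).eval c) := by
    intro t
    unfold lauricellaPhi2
    refine tsum_congr fun m => ?_
    simp only [w, d]
    rw [← Finset.prod_pow_eq_pow_sum, div_mul_eq_mul_div, ← Finset.prod_mul_distrib, ← mul_div_assoc,
      ← Finset.prod_mul_distrib]
    congr 1
    refine Finset.prod_congr rfl fun n _ => ?_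
    rw [mul_pow]; ring
  obtain ⟨h, hh1, hh2⟩ := core_aux w d A c hA hc g hg
  let Gr : ℝ → ℝ := fun z => (1 - A * z) ^ (B - c) * ∏ n, (1 - (A + a n) * z) ^ (-(b n))
  let G : ℂ → ℂ := fun z => (1 - A * z) ^ ((B - c : ℝ) : ℂ) *
    ∏ n, (1 - ((A + a n : ℝ) : ℂ) * z) ^ ((-(b n) : ℝ) : ℂ)
  have hcoef : ∀ n, 0 ≤ A + a n ∧ A + a n ≤ A := fun n =>
    ⟨by linarith [neg_abs_le (a n), hA1 n], by linarith [ha n]⟩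
  have hposA : ∀ z, z < 1 / A → 0 < 1 - A * z := by
    intro z hz
    rw [lt_div_iff₀ hA] at hz
    linarith
  have hposn : ∀ n z, 0 < z → z < 1 / A → 0 < 1 - (A + a n) * z := by
    intro n z hz0 hz
    nlinarith [hposA z hz, hcoef n]
  have hGG : ∀ z : ℝ, 0 < z → z < 1 / A → G z = (Gr z : ℂ) := by
    intro z hz0 hz
    simp only [G, Gr]
    push_cast [Complex.ofReal_cpow (hposA z hz).le, fun n => Complex.ofReal_cpow (hposn n z hz0 hz).le]
    rfl
  have hGdiff : DifferentiableOn ℂ G (Metric.ball 0 (1 / A)) := by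
    have key : ∀ α : ℝ, 0 ≤ α → α ≤ A → ∀ z ∈ Metric.ball (0:ℂ) (1 / A),
        1 - (α : ℂ) * z ∈ Complex.slitPlane := by
      intro α h0 h1 z hz
      left
      rw [mem_ball_zero_iff, lt_div_iff₀ hA] at hz
      have h2 := Complex.re_le_norm z
      have h3 := norm_nonneg z
      simp only [Complex.sub_re, Complex.one_re, Complex.re_ofReal_mul]
      nlinarith
    have dif : ∀ α β : ℝ, 0 ≤ α → α ≤ A → DifferentiableOn ℂ
        (fun z : ℂ => (1 - (α : ℂ) * z) ^ (β : ℂ)) (Metric.ball 0 (1 / A)) := by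
      intro α β h0 h1
      refine DifferentiableOn.cpow (by fun_prop) (by fun_prop) (key α h0 h1)
    refine (dif A _ hA.le le_rfl).mul ?_
    exact DifferentiableOn.fun_finsetProd fun n _ => dif _ _ (hcoef n).1 (hcoef n).2
  have h2A : 1 / (2 * A) ≤ 1 / A := by
    apply one_div_le_one_div_of_le hA; linarith
  have hsmall : ∀ z : ℝ, 0 < z → z < 1 / (2 * A) →
      HasSum (fun k => (h k : ℂ) * (z:ℂ) ^ k) (G z) := by
    intro z hz hz'
    have hzA : z < 1 / A := by linarith
    have h1 := hh2 z hz hz'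
    have hp := hposA z hzA
    have e : (1 - A * z) ^ (-c) * g (z / (1 - A * z)) = Gr z := by
      simp only [g, Gr]
      have e1 : ∀ n, (1 - a n * (z / (1 - A * z))) ^ (-(b n)) =
          (1 - A * z) ^ (b n) * (1 - (A + a n) * z) ^ (-(b n)) := by
        intro n
        have hn := hposn n z hz hzA
        rw [show 1 - a n * (z / (1 - A * z)) = (1 - (A + a n) * z) / (1 - A * z) by
          have hp' := hp.ne'
          rw [eq_div_iff hp', sub_mul, mul_assoc, div_mul_cancel₀ _ hp']; ring, Real.div_rpow hn.le hp.le, Real.rpow_neg hp.le]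
        field_simp
      simp_rw [e1]
      rw [Finset.prod_mul_distrib, ← Real.rpow_sum_of_pos hp, ← mul_assoc, ← Real.rpow_add hp,
        neg_add_eq_sub]
    rw [e] at h1
    rw [hGG z hz hzA]
    have h2 := Complex.hasSum_ofReal.2 h1
    refine (lau_hasSum_congr fun k => ?_).2 h2
    push_cast; rfl
  have hσ : 0 < s + A := by linarith
  have hu : 1 / (s + A) < 1 / A := one_div_lt_one_div_of_lt hA (by linarith)
  have hu0 : 0 < 1 / (s + A) := by positivity
  have hbig := extend_aux h (1 / (2 * A)) (1 / A) (by positivity) h2A G hGdiff hsmall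
    (1 / (s + A)) hu0 hu
  rw [hGG _ hu0 hu] at hbig
  have hL : HasSum (fun k => h k * (1 / (s + A)) ^ k) (Gr (1 / (s + A))) := by
    apply Complex.hasSum_ofReal.1
    refine (lau_hasSum_congr fun k => ?_).2 hbig
    push_cast; rfl
  obtain ⟨hint, hval⟩ := laplace_series c (s + A) hc hσ h _ hL
  have hfun : (fun t : ℝ => Real.exp (-(s + A) * t) * t ^ (c - 1) *
      ∑' k, h k * (t ^ k / (ascPochhammer ℝ k).eval c)) =
      fun t : ℝ => Real.exp (-s * t) * t ^ (c - 1) * lauricellaPhi2 N b c (fun n => a n * t) := by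
    funext t
    rw [(hh1 t).tsum_eq, hPhi t, show -s * t = -(s + A) * t + A * t by ring, Real.exp_add]
    ring
  rw [hfun] at hint hval
  refine ⟨hint, hval.trans ?_⟩
  simp only [Gr]
  have e0 : 1 - A * (1 / (s + A)) = s / (s + A) := by field_simp; ring
  have e1 : ∀ n, (1 - (A + a n) * (1 / (s + A))) ^ (-(b n)) =
      (s / (s + A)) ^ (-(b n)) * (1 - a n / s) ^ (-(b n)) := by
    intro n
    have : 0 ≤ 1 - a n / s := by
      have := div_nonpos_of_nonpos_of_nonneg (ha n) hs.le
      linarith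
    rw [← Real.mul_rpow (by positivity) this]
    congr 1
    field_simp
    ring
  have hq : 0 < s / (s + A) := by positivity
  simp_rw [e0, e1]
  have e2 : (s / (s + A)) ^ (B - c) * (s / (s + A)) ^ (-B) = (s / (s + A)) ^ (-c) := by
    rw [← Real.rpow_add hq]; congr 1; ring
  have e3 : (s + A) ^ (-c) * (s / (s + A)) ^ (-c) = s ^ (-c) := by
    rw [← Real.mul_rpow hσ.le hq.le, mul_div_cancel₀ _ hσ.ne']
  rw [Finset.prod_mul_distrib, ← Real.rpow_sum_of_pos hq, Finset.sum_neg_distrib, ← hB, ← e3, ← e2]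
  ring
end

section
/- Let N be a positive integer, α > 0, and λ₁, …, λ_N > 0. Let Y be a real-valued random variable on a probability space with Y ≥ 0 almost surely, whose Laplace transform satisfies E[e^{−sY}] = ∏_{n=1}^N (1 + λ_n s)^{−α} for every s > 0. Then the law of Y is absolutely continuous with respect to Lebesgue measure, with probability density function f_Y(y) = y^{Nα − 1} / ( (∏_{n=1}^N λ_n)^{α} · Γ(Nα) ) · Φ₂^(N)(α, …, α; Nα; −y/λ₁, …, −y/λ_N) for y > 0 (and f_Y(y) = 0 for y ≤ 0). -/
open scoped BigOperators
open MeasureTheory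
open scoped ProbabilityTheory

section Aux
open ProbabilityTheory

theorem laplace_unique (μ ν : Measure ℝ) [IsFiniteMeasure μ] [IsFiniteMeasure ν] (ε : ℝ) (hε : 0 < ε)
    (hμ : ∀ t, |t| < ε → Integrable (fun x => Real.exp (t * x)) μ)
    (hν : ∀ t, |t| < ε → Integrable (fun x => Real.exp (t * x)) ν)
    (h : ∀ t, |t| < ε → ∫ x, Real.exp (t * x) ∂μ = ∫ x, Real.exp (t * x) ∂ν) : μ = ν := by
  have hmem : Metric.ball (0:ℝ) ε ⊆ interior (integrableExpSet id μ) := by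
    apply interior_maximal _ Metric.isOpen_ball
    intro t ht
    exact hμ t (by simpa using ht)
  have hmem' : Metric.ball (0:ℝ) ε ⊆ interior (integrableExpSet id ν) := by
    apply interior_maximal _ Metric.isOpen_ball
    intro t ht
    exact hν t (by simpa using ht)
  have hX : AnalyticOnNhd ℂ (complexMGF id μ) {z | z.re ∈ Metric.ball (0:ℝ) ε} :=
    analyticOnNhd_complexMGF.mono (fun z hz => hmem hz)
  have hY : AnalyticOnNhd ℂ (complexMGF id ν) {z | z.re ∈ Metric.ball (0:ℝ) ε} :=
    analyticOnNhd_complexMGF.mono (fun z hz => hmem' hz)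
  have key : Set.EqOn (complexMGF id μ) (complexMGF id ν) {z | z.re ∈ Metric.ball (0:ℝ) ε} := by
    refine AnalyticOnNhd.eqOn_of_preconnected_of_frequently_eq hX hY
      ((convex_ball (0:ℝ) ε).linear_preimage Complex.reLm).isPreconnected
      (z₀ := ((0:ℝ) : ℂ)) (by simp [hε]) ?_
    have h_real : ∃ᶠ (x : ℝ) in nhdsWithin 0 {0}ᶜ, complexMGF id μ x = complexMGF id ν x := by
      apply Filter.Eventually.frequently
      filter_upwards [mem_nhdsWithin_of_mem_nhds (Metric.ball_mem_nhds (0:ℝ) hε)] with t ht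
      rw [complexMGF_ofReal, complexMGF_ofReal]
      have := h t (by simpa using ht)
      simp [mgf, this]
    rw [Filter.frequently_iff_seq_forall] at h_real ⊢
    obtain ⟨xs, hx_tendsto, hx_eq⟩ := h_real
    refine ⟨fun n ↦ xs n, ?_, fun n ↦ ?_⟩
    · rw [tendsto_nhdsWithin_iff] at hx_tendsto ⊢
      constructor
      · exact (Complex.continuous_ofReal.tendsto 0).comp hx_tendsto.1
      · simpa using hx_tendsto.2
    · simp [hx_eq]
  apply Measure.ext_of_charFun
  funext t
  rw [← complexMGF_id_mul_I, ← complexMGF_id_mul_I]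
  apply key
  simp [hε]

theorem Gamma_add_nat_aux (c : ℝ) (hc : 0 < c) (k : ℕ) :
    Real.Gamma (c + k) = Real.Gamma c * (ascPochhammer ℝ k).eval c := by
  induction k with
  | zero => simp
  | succ k ih =>
    push_cast
    rw [← add_assoc, Real.Gamma_add_one (by positivity), ih, ascPochhammer_succ_eval]
    ring

theorem binom_aux (α x : ℝ) (hx : |x| < 1) :
    HasSum (fun k : ℕ => (ascPochhammer ℝ k).eval α * (x ^ k / (Nat.factorial k))) ((1 - x) ^ (-α)) := by
  have h := (Real.one_add_rpow_hasFPowerSeriesOnBall_zero (a := -α)).hasSum (y := -x)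
    (by simpa [← ofReal_norm, ENNReal.ofReal_lt_one] using hx)
  rw [zero_add, ← sub_eq_add_neg] at h
  refine HasSum.congr_fun h (fun k => ?_)
  have h1 := Ring.factorial_nsmul_multichoose_eq_ascPochhammer α k
  rw [Polynomial.ascPochhammer_smeval_eq_eval, nsmul_eq_mul] at h1
  rw [binomialSeries_apply, Ring.choose_neg', ← h1]
  have : (Nat.factorial k : ℝ) ≠ 0 := by positivity
  simp only [List.ofFn_const, List.prod_replicate, smul_eq_mul, Units.smul_def, zsmul_eq_mul]
  field_simp
  have hneg : (((Int.negOnePow k : ℤˣ) : ℤ) : ℝ) = (-1) ^ k := by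
    rw [Int.negOnePow_def]; simp [zpow_natCast]
  rw [neg_pow x k, hneg]
  rw [show (Ring.multichoose α k * x^k) = (((-1:ℝ)^k)*(-1)^k) * (Ring.multichoose α k * x^k) by rw [← mul_pow]; simp]
  ring

theorem prod_aux (N : ℕ) (f : Fin N → ℕ → ℝ) (hf : ∀ n, Summable fun k => ‖f n k‖) :
    (Summable fun m : Fin N → ℕ => ‖∏ n, f n (m n)‖) ∧
    ∑' m : Fin N → ℕ, ∏ n, f n (m n) = ∏ n, ∑' k, f n k := by
  induction N with
  | zero =>
    constructor
    · exact Summable.of_finite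
    · simp 
  | succ N ih =>
    obtain ⟨h1, h2⟩ := ih (fun n => f n.succ) (fun n => hf _)
    have e := Fin.consEquiv (fun _ : Fin (N+1) => ℕ)
    constructor
    · rw [← (Fin.consEquiv (fun _ : Fin (N+1) => ℕ)).summable_iff]
      simpa [Function.comp_def, Fin.prod_univ_succ] using summable_mul_of_summable_norm (hf 0).norm h1.norm
    · rw [← (Fin.consEquiv (fun _ : Fin (N+1) => ℕ)).tsum_eq]
      rw [Fin.prod_univ_succ, ← h2, tsum_mul_tsum_of_summable_norm (hf 0) h1]
      simp [Fin.prod_univ_succ]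

theorem integrable_tsum_aux {ι β : Type*} [Countable ι] [MeasurableSpace β] (μ : Measure β) (F : ι → β → ℝ)
    (hm : ∀ i, Measurable (F i))
    (hF : ∀ i, Integrable (F i) μ) (hS : Summable fun i => ∫ a, ‖F i a‖ ∂μ) :
    Integrable (fun a => ∑' i, F i a) μ := by
  refine ⟨(Measurable.tsum hm).aestronglyMeasurable, ?_⟩
  refine lt_of_le_of_lt (lintegral_mono (fun a => enorm_tsum_le_tsum_enorm)) ?_
  rw [lintegral_tsum (fun i => (hm i).enorm.aemeasurable)]
  have : ∀ i, ∫⁻ a, ‖F i a‖ₑ ∂μ = ENNReal.ofReal (∫ a, ‖F i a‖ ∂μ) := by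
    intro i
    rw [ofReal_integral_norm_eq_lintegral_enorm (hF i)]
  simp_rw [this]
  exact hS.tsum_ofReal_lt_top

/-- one term of the density times exponential -/
noncomputable def termAux (N : ℕ) (α : ℝ) (lam : Fin N → ℝ) (s : ℝ) (m : Fin N → ℕ) (y : ℝ) : ℝ :=
  ((1 / ((∏ n, lam n) ^ α * Real.Gamma ((N : ℝ) * α))) *
    ((∏ n, (ascPochhammer ℝ (m n)).eval α) / (ascPochhammer ℝ (∑ n, m n)).eval ((N : ℝ) * α)) *
      ∏ n, (-1 / lam n) ^ m n / (Nat.factorial (m n))) *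
  (y ^ ((N : ℝ) * α + (∑ n, m n : ℕ) - 1) * Real.exp (-(s * y)))

theorem termAux_measurable (N : ℕ) (α : ℝ) (lam : Fin N → ℝ) (s : ℝ) (m : Fin N → ℕ) :
    Measurable (termAux N α lam s m) := by
  unfold termAux
  fun_prop

theorem termAux_sum (N : ℕ) (α : ℝ) (lam : Fin N → ℝ) (s : ℝ) (y : ℝ) (hy : 0 < y) :
    ∑' m, termAux N α lam s m y = Real.exp (-(s * y)) *
      (y ^ ((N : ℝ) * α - 1) / ((∏ n, lam n) ^ α * Real.Gamma ((N : ℝ) * α)) *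
              lauricellaPhi2 N (fun _ => α) ((N : ℝ) * α) (fun n => -y / lam n)) := by
  unfold lauricellaPhi2
  rw [← mul_assoc, ← tsum_mul_left]
  congr 1
  funext m
  unfold termAux
  have h1 : y ^ ((N : ℝ) * α + (∑ n, m n : ℕ) - 1) = y ^ ((N : ℝ) * α - 1) * ∏ n, y ^ m n := by
    rw [Finset.prod_pow_eq_pow_sum, ← Real.rpow_natCast, ← Real.rpow_add hy]
    congr 1
    ring
  have h2 : ∏ n, (-y / lam n) ^ m n / (Nat.factorial (m n) : ℝ)
      = (∏ n, y ^ m n) * ∏ n, (-1 / lam n) ^ m n / (Nat.factorial (m n) : ℝ) := by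
    rw [← Finset.prod_mul_distrib]
    apply Finset.prod_congr rfl
    intro n _
    rw [show -y / lam n = y * (-1 / lam n) by ring, mul_pow]
    ring
  rw [h1, h2]
  ring

theorem termAux_integral (N : ℕ) (hN : 0 < N) (α : ℝ) (hα : 0 < α) (lam : Fin N → ℝ)
    (hlam : ∀ n, 0 < lam n) (s : ℝ) (hs : 0 < s) (m : Fin N → ℕ) :
    IntegrableOn (termAux N α lam s m) (Set.Ioi 0) ∧
    ∫ y in Set.Ioi 0, termAux N α lam s m y = (1 / ((∏ n, lam n) ^ α)) * (1 / s) ^ ((N : ℝ) * α) *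
      ∏ n, ((ascPochhammer ℝ (m n)).eval α * ((-1 / (lam n * s)) ^ m n / (Nat.factorial (m n)))) ∧
    ∫ y in Set.Ioi 0, ‖termAux N α lam s m y‖ = ‖∫ y in Set.Ioi 0, termAux N α lam s m y‖ := by
  have hc : 0 < (N : ℝ) * α := by positivity
  have hck : 0 < (N : ℝ) * α + (∑ n, m n : ℕ) := by positivity
  have hint := Real.integral_rpow_mul_exp_neg_mul_Ioi hck hs
  have hpos : 0 < (1 / s) ^ ((N : ℝ) * α + (∑ n, m n : ℕ)) * Real.Gamma ((N : ℝ) * α + (∑ n, m n : ℕ)) :=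
    mul_pos (by positivity) (Real.Gamma_pos_of_pos hck)
  have hI : IntegrableOn (fun y => y ^ ((N : ℝ) * α + (∑ n, m n : ℕ) - 1) * Real.exp (-(s * y))) (Set.Ioi 0) := by
    apply Integrable.of_integral_ne_zero
    rw [hint]; exact hpos.ne'
  unfold termAux
  refine ⟨hI.const_mul _, ?_, ?_⟩
  · rw [integral_const_mul, hint, Gamma_add_nat_aux _ hc, Real.rpow_add (by positivity), Real.rpow_natCast,
      ← Finset.prod_pow_eq_pow_sum, Finset.prod_mul_distrib]
    have h2 : ∏ n, (-1 / (lam n * s)) ^ m n / (Nat.factorial (m n) : ℝ)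
      = (∏ n, (1 / s) ^ m n) * ∏ n, (-1 / lam n) ^ m n / (Nat.factorial (m n) : ℝ) := by
      rw [← Finset.prod_mul_distrib]
      apply Finset.prod_congr rfl
      intro n _
      rw [show -1 / (lam n * s) = (1 / s) * (-1 / lam n) by field_simp, mul_pow]
      ring
    rw [h2]
    have := (Real.Gamma_pos_of_pos hc).ne'
    have := (ascPochhammer_pos (∑ n, m n) _ hc).ne'
    have : (∏ n, lam n) ^ α ≠ 0 := (Real.rpow_pos_of_pos (Finset.prod_pos fun n _ => hlam n) _).ne'
    field_simp
  · rw [integral_const_mul, norm_mul, hint, Real.norm_of_nonneg hpos.le, ← hint, ← integral_const_mul]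
    apply setIntegral_congr_fun measurableSet_Ioi
    intro y hy
    have hy' : 0 < y := hy
    simp only
    rw [norm_mul]
    congr 1
    rw [Real.norm_of_nonneg]
    positivity

theorem laplace_density (N : ℕ) (hN : 0 < N) (α : ℝ) (hα : 0 < α) (lam : Fin N → ℝ)
    (hlam : ∀ n, 0 < lam n) (s : ℝ) (hs : 0 < s) (hs' : ∀ n, 1 / lam n < s) :
    IntegrableOn (fun y => Real.exp (-(s * y)) *
      (y ^ ((N : ℝ) * α - 1) / ((∏ n, lam n) ^ α * Real.Gamma ((N : ℝ) * α)) *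
              lauricellaPhi2 N (fun _ => α) ((N : ℝ) * α) (fun n => -y / lam n))) (Set.Ioi 0) ∧
    ∫ y in Set.Ioi 0, Real.exp (-(s * y)) *
      (y ^ ((N : ℝ) * α - 1) / ((∏ n, lam n) ^ α * Real.Gamma ((N : ℝ) * α)) *
              lauricellaPhi2 N (fun _ => α) ((N : ℝ) * α) (fun n => -y / lam n)) =
      ∏ n, (1 + lam n * s) ^ (-α) := by
  have hx : ∀ n, |(-1 / (lam n * s))| < 1 := by
    intro n
    have := hlam n
    have h := hs' n
    rw [abs_div, abs_neg, abs_one, abs_of_pos (by positivity), div_lt_one (by positivity)]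
    rw [div_lt_iff₀ this] at h
    linarith
  have hb := fun n => binom_aux α _ (hx n)
  obtain ⟨p1, p2⟩ := prod_aux N (fun n k => (ascPochhammer ℝ k).eval α * ((-1 / (lam n * s)) ^ k / (Nat.factorial k)))
    (fun n => (hb n).summable.norm)
  have hT := termAux_integral N hN α hα lam hlam s hs
  have hsum : Summable fun m => ∫ y in Set.Ioi 0, ‖termAux N α lam s m y‖ := by
    simp_rw [fun m => (hT m).2.2, fun m => (hT m).2.1, norm_mul _ (∏ n, _)]
    exact p1.mul_left _
  have e : Set.EqOn (fun y => ∑' m, termAux N α lam s m y) (fun y => Real.exp (-(s * y)) *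
      (y ^ ((N : ℝ) * α - 1) / ((∏ n, lam n) ^ α * Real.Gamma ((N : ℝ) * α)) *
              lauricellaPhi2 N (fun _ => α) ((N : ℝ) * α) (fun n => -y / lam n))) (Set.Ioi 0) :=
    fun y hy => termAux_sum N α lam s y hy
  have i1 := integrable_tsum_aux (volume.restrict (Set.Ioi 0)) (termAux N α lam s)
    (termAux_measurable N α lam s) (fun m => (hT m).1) hsum
  refine ⟨IntegrableOn.congr_fun i1 e measurableSet_Ioi, ?_⟩
  rw [← setIntegral_congr_fun measurableSet_Ioi e,
    ← integral_tsum_of_summable_integral_norm (fun m => (hT m).1) hsum]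
  simp_rw [fun m => (hT m).2.1]
  rw [tsum_mul_left, p2]
  simp_rw [fun n => (hb n).tsum_eq]
  rw [Real.rpow_natCast_mul (by positivity), ← Real.finsetProd_rpow _ _ (fun n _ => (hlam n).le)]
  rw [one_div, ← Finset.prod_inv_distrib]
  have : ((1 / s) ^ N) ^ α = ∏ n : Fin N, (1 / s) ^ α := by
    rw [Finset.prod_const, Finset.card_univ, Fintype.card_fin, Real.rpow_pow_comm (by positivity)]
  rw [this, ← Finset.prod_mul_distrib, ← Finset.prod_mul_distrib]
  apply Finset.prod_congr rfl
  intro n _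
  have hl := hlam n
  rw [← Real.inv_rpow hl.le, ← Real.mul_rpow (by positivity) (by positivity),
    show 1 - -1 / (lam n * s) = 1 + 1 / (lam n * s) by ring, Real.rpow_neg (by positivity),
    ← Real.inv_rpow (by positivity), ← Real.mul_rpow (by positivity) (by positivity),
    Real.rpow_neg (by positivity), ← Real.inv_rpow (by positivity)]
  congr 1
  field_simp
  ring

theorem withDensity_aux (μ : Measure ℝ) (h g : ℝ → ℝ) (hh : Measurable h) (hg : ∀ x, 0 ≤ g x)
    (hi : Integrable (fun x => h x * g x) μ) :
    Integrable g (μ.withDensity (fun x => ENNReal.ofReal (h x))) ∧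
    ∫ x, g x ∂(μ.withDensity (fun x => ENNReal.ofReal (h x))) = ∫ x, max (h x * g x) 0 ∂μ := by
  have e : (fun x => (ENNReal.ofReal (h x)).toReal • g x) = fun x => max (h x * g x) 0 := by
    funext x
    rw [smul_eq_mul, ENNReal.toReal_ofReal', max_mul_of_nonneg _ _ (hg x), zero_mul]
  rw [integrable_withDensity_iff_integrable_smul' (by fun_prop) (by simp),
    integral_withDensity_eq_integral_toReal_smul (by fun_prop) (by simp), e]
  exact ⟨hi.pos_part, rfl⟩

theorem final_aux (μ : Measure ℝ) [IsFiniteMeasure μ] (hμ : ∀ᵐ x ∂μ, 0 ≤ x) (g : ℝ → ℝ) (hg : Measurable g)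
    (S : ℝ) (hS : 0 < S)
    (hi : ∀ s, S < s → Integrable (fun y => Real.exp (-(s * y)) * g y))
    (he : ∀ s, S < s → ∫ y, Real.exp (-(s * y)) * g y = ∫ y, Real.exp (-(s * y)) ∂μ) :
    μ = volume.withDensity (fun y => ENNReal.ofReal (g y)) := by
  set E : ℝ → ℝ := fun y => Real.exp (-((S + 1) * y)) with hE
  have hEm : Measurable E := by fun_prop
  set h : ℝ → ℝ := fun y => E y * g y with hh
  have hhm : Measurable h := by fun_prop
  have hexp : ∀ t y, E y * Real.exp (t * y) = Real.exp (-((S + 1 - t) * y)) := by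
    intro t y
    rw [hE, ← Real.exp_add]; congr 1; ring
  have hht : ∀ t, (fun y => h y * Real.exp (t * y)) = fun y => Real.exp (-((S + 1 - t) * y)) * g y := by
    intro t; funext y
    rw [← hexp, hh]; ring
  have hS1 : ∀ t, |t| < 1 → S < S + 1 - t := by
    intro t ht
    have := (abs_lt.mp ht).2
    linarith
  have iμ : ∀ s, S < s → Integrable (fun y => Real.exp (-(s * y))) μ := by
    intro s hs
    refine Integrable.mono' (integrable_const (1 : ℝ)) (by fun_prop) ?_
    filter_upwards [hμ] with y hy
    rw [Real.norm_of_nonneg (Real.exp_nonneg _), Real.exp_le_one_iff]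
    nlinarith [mul_nonneg (hS.le.trans hs.le) hy]
  have a1 : ∀ t : ℝ, |t| < 1 → _ := fun t ht => withDensity_aux μ E (fun y => Real.exp (t * y)) hEm
    (fun _ => Real.exp_nonneg _) (by simp_rw [hexp]; exact iμ _ (hS1 t ht))
  have hiv : ∀ t, |t| < 1 → Integrable (fun y => h y * Real.exp (t * y)) := by
    intro t ht
    rw [hht]; exact hi _ (hS1 t ht)
  have hiv' : ∀ t, |t| < 1 → Integrable (fun y => -h y * Real.exp (t * y)) := by
    intro t ht
    simpa [neg_mul] using (hiv t ht).neg
  have a2 : ∀ t : ℝ, |t| < 1 → _ := fun t ht => withDensity_aux volume h (fun y => Real.exp (t * y)) hhm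
    (fun _ => Real.exp_nonneg _) (hiv t ht)
  have a3 : ∀ t : ℝ, |t| < 1 → _ := fun t ht => withDensity_aux volume (fun y => -h y) (fun y => Real.exp (t * y)) hhm.neg
    (fun _ => Real.exp_nonneg _) (hiv' t ht)
  have f1 : IsFiniteMeasure (μ.withDensity (fun y => ENNReal.ofReal (E y))) :=
    isFiniteMeasure_withDensity_ofReal (iμ (S + 1) (by linarith)).2
  have hih : Integrable h := by simpa using hiv 0 (by simp)
  have f2 : IsFiniteMeasure (volume.withDensity (fun y => ENNReal.ofReal (h y))) :=
    isFiniteMeasure_withDensity_ofReal hih.2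
  have f3 : IsFiniteMeasure (volume.withDensity (fun y => ENNReal.ofReal (-h y))) :=
    isFiniteMeasure_withDensity_ofReal hih.neg.2
  have key : μ.withDensity (fun y => ENNReal.ofReal (E y)) + volume.withDensity (fun y => ENNReal.ofReal (-h y))
      = volume.withDensity (fun y => ENNReal.ofReal (h y)) := by
    apply laplace_unique _ _ 1 one_pos
    · intro t ht
      exact integrable_add_measure.mpr ⟨(a1 t ht).1, (a3 t ht).1⟩
    · intro t ht
      exact (a2 t ht).1
    · intro t ht
      rw [integral_add_measure (a1 t ht).1 (a3 t ht).1, (a1 t ht).2, (a2 t ht).2, (a3 t ht).2]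
      have e1 : ∫ x, max (E x * Real.exp (t * x)) 0 ∂μ = ∫ y, h y * Real.exp (t * y) := by
        rw [hht, he _ (hS1 t ht)]
        congr 1
        funext y
        rw [hexp, max_eq_left (Real.exp_nonneg _)]
      rw [e1, ← integral_add (hiv t ht) (hiv' t ht).pos_part]
      congr 1
      funext y
      rcases le_total (h y * Real.exp (t * y)) 0 with h0 | h0
      · rw [max_eq_right h0, max_eq_left (by linarith)]; ring
      · rw [max_eq_left h0, max_eq_right (by linarith)]; ring
  have hA : MeasurableSet {y | h y < 0} := measurableSet_lt hhm measurable_const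
  have z0 : volume.withDensity (fun y => ENNReal.ofReal (h y)) {y | h y < 0} = 0 := by
    rw [withDensity_apply _ hA, setLIntegral_congr_fun hA (g := fun _ => 0)]
    · simp
    · intro y hy
      exact ENNReal.ofReal_of_nonpos (le_of_lt hy)
  have z1 : volume.withDensity (fun y => ENNReal.ofReal (-h y)) {y | h y < 0} = 0 := by
    rw [← key, Measure.add_apply] at z0
    exact (add_eq_zero.mp z0).2
  have z2 : volume.withDensity (fun y => ENNReal.ofReal (-h y)) {y | h y < 0}ᶜ = 0 := by
    rw [withDensity_apply _ hA.compl, setLIntegral_congr_fun hA.compl (g := fun _ => 0)]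
    · simp
    · intro y hy
      refine ENNReal.ofReal_of_nonpos ?_
      have : ¬ h y < 0 := hy
      linarith
  have z3 : volume.withDensity (fun y => ENNReal.ofReal (-h y)) = 0 := by
    rw [← Measure.measure_univ_eq_zero, ← measure_add_measure_compl hA, z1, z2, add_zero]
  rw [z3, add_zero] at key
  have hEi : Measurable (fun y : ℝ => ENNReal.ofReal (E y)⁻¹) := by fun_prop
  have key2 := congrArg (fun m : Measure ℝ => m.withDensity (fun y => ENNReal.ofReal (E y)⁻¹)) key
  rw [← withDensity_mul _ (by fun_prop) hEi, ← withDensity_mul _ (by fun_prop) hEi] at key2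
  have hEp : ∀ y, 0 < E y := fun y => Real.exp_pos _
  have e1 : ((fun y => ENNReal.ofReal (E y)) * fun y => ENNReal.ofReal (E y)⁻¹) = 1 := by
    funext y
    simp only [Pi.mul_apply, Pi.one_apply]
    rw [← ENNReal.ofReal_mul (hEp y).le, mul_inv_cancel₀ (hEp y).ne', ENNReal.ofReal_one]
  have e2 : ((fun y => ENNReal.ofReal (h y)) * fun y => ENNReal.ofReal (E y)⁻¹) = fun y => ENNReal.ofReal (g y) := by
    funext y
    simp only [Pi.mul_apply]
    rw [← ENNReal.ofReal_mul' (inv_pos.mpr (hEp y)).le]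
    congr 1
    have := (hEp y).ne'
    simp only [hh]
    field_simp
  rw [e1, e2, withDensity_one] at key2
  exact key2

theorem lauricella_measurable (N : ℕ) (b : Fin N → ℝ) (c : ℝ) (x : Fin N → ℝ → ℝ) (hx : ∀ n, Measurable (x n)) :
    Measurable (fun y => lauricellaPhi2 N b c (fun n => x n y)) := by
  unfold lauricellaPhi2
  apply Measurable.tsum
  intro m
  fun_prop

end Aux

/-- If `Y ≥ 0` a.s. has Laplace transform `E[e^{−sY}] = ∏ (1 + λₙ s)^{−α}` for all `s > 0`,
then the law of `Y` is absolutely continuous w.r.t. Lebesgue measure with density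
`f_Y(y) = y^{Nα−1} / ((∏ λₙ)^α Γ(Nα)) · Φ₂^(N)(α,…,α; Nα; −y/λ₁,…,−y/λ_N)` for `y > 0`
and `f_Y(y) = 0` for `y ≤ 0`. -/
theorem pdf_sum_correlated_gamma {Ω : Type*} [MeasureSpace Ω]
    [IsProbabilityMeasure (ℙ : Measure Ω)]
    (N : ℕ) (hN : 0 < N) (α : ℝ) (hα : 0 < α)
    (lam : Fin N → ℝ) (hlam : ∀ n, 0 < lam n)
    (Y : Ω → ℝ) (hY : Measurable Y) (hYnonneg : ∀ᵐ ω, 0 ≤ Y ω)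
    (hLaplace : ∀ s : ℝ, 0 < s →
      ∫ ω, Real.exp (-s * Y ω) = ∏ n, (1 + lam n * s) ^ (-α)) :
    Measure.map Y ℙ =
      volume.withDensity (fun y : ℝ =>
        if 0 < y then
          ENNReal.ofReal
            (y ^ ((N : ℝ) * α - 1) / ((∏ n, lam n) ^ α * Real.Gamma ((N : ℝ) * α)) *
              lauricellaPhi2 N (fun _ => α) ((N : ℝ) * α) (fun n => -y / lam n))
        else 0) := by
  set F : ℝ → ℝ := fun y => y ^ ((N : ℝ) * α - 1) / ((∏ n, lam n) ^ α * Real.Gamma ((N : ℝ) * α)) *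
              lauricellaPhi2 N (fun _ => α) ((N : ℝ) * α) (fun n => -y / lam n) with hF
  have hFm : Measurable F := by
    have := lauricella_measurable N (fun _ => α) ((N : ℝ) * α) (fun n y => -y / lam n) (fun n => by fun_prop)
    fun_prop
  have e : (fun y : ℝ => if 0 < y then ENNReal.ofReal (F y) else 0) =
      fun y => ENNReal.ofReal ((Set.Ioi 0).indicator F y) := by
    funext y
    by_cases hy : 0 < y
    · simp [hy]
    · simp [hy]
  change _ = volume.withDensity (fun y : ℝ => if 0 < y then ENNReal.ofReal (F y) else 0)
  rw [e]
  have : IsProbabilityMeasure (Measure.map Y ℙ) := Measure.isProbabilityMeasure_map hY.aemeasurable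
  have hSp : 0 ≤ ∑ n, 1 / lam n := Finset.sum_nonneg fun n _ => (one_div_pos.mpr (hlam n)).le
  have hS : ∀ s, ∑ n, 1 / lam n + 1 < s → ∀ n, 1 / lam n < s := by
    intro s hs n
    have := Finset.single_le_sum (f := fun n => 1 / lam n)
      (fun n _ => (one_div_pos.mpr (hlam n)).le) (Finset.mem_univ n)
    linarith
  have ei : ∀ s : ℝ, (fun y => Real.exp (-(s * y)) * (Set.Ioi 0).indicator F y) =
      (Set.Ioi 0).indicator (fun y => Real.exp (-(s * y)) * F y) := by
    intro s
    funext y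
    by_cases hy : 0 < y
    · simp [hy]
    · simp [hy]
  refine final_aux _ ?_ _ (hFm.indicator measurableSet_Ioi) (∑ n, 1 / lam n + 1) (by linarith) ?_ ?_
  · rw [ae_map_iff hY.aemeasurable measurableSet_Ici]
    exact hYnonneg
  · intro s hs
    rw [ei, integrable_indicator_iff measurableSet_Ioi]
    exact (laplace_density N hN α hα lam hlam s (by linarith) (hS s hs)).1
  · intro s hs
    rw [ei, integral_indicator measurableSet_Ioi, integral_map hY.aemeasurable (by fun_prop)]
    rw [(laplace_density N hN α hα lam hlam s (by linarith) (hS s hs)).2, ← hLaplace s (by linarith)]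
    simp only [neg_mul]
end
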